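/- arXiv:1704.01368 — 5 statements merged into one kernel-verified Lean document; each statement's English description precedes it below -/
import Mathlib

section
/- Fix real parameters ω > 0, χ > 0, ζ > 0 and set γ = ωχ. Define F₂′(P) = −2χP + γ + ζ e^{ω/P}(ω − 2P) for P > 0. Then F₂′ is strictly decreasing on (0, ∞). -/
/-- `F₂'(P) = -2χP + γ + ζ e^{ω/P} (ω - 2P)`, where `γ = ωχ`. -/
noncomputable def F2deriv (ω χ γ ζ : ℝ) (P : ℝ) : ℝ :=
  -2 * χ * P + γ + ζ * Real.exp (ω / P) * (ω - 2 * P)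

theorem hasDerivAt_F2deriv (ω χ γ ζ : ℝ) {P : ℝ} (hP : P ≠ 0) :
    HasDerivAt (F2deriv ω χ γ ζ)
      (-2 * χ - ζ * Real.exp (ω / P) * (((ω - P) ^ 2 + P ^ 2) / P ^ 2)) P := by
  have hlin : HasDerivAt (fun x : ℝ => -2 * χ * x + γ) (-2 * χ * 1) P :=
    ((hasDerivAt_id P).const_mul (-2 * χ)).add_const γ
  have hdiv : HasDerivAt (fun x : ℝ => ω / x) (ω * -(P ^ 2)⁻¹) P := by
    simpa only [div_eq_mul_inv] using (hasDerivAt_inv hP).const_mul ω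
  have hsub : HasDerivAt (fun x : ℝ => ω - 2 * x) (-(2 * 1)) P :=
    ((hasDerivAt_id P).const_mul 2).const_sub ω
  refine (hlin.add ((hdiv.exp.const_mul ζ).mul hsub)).congr_deriv ?_
  field_simp
  ring

/-- `F₂'` is strictly decreasing on `(0, ∞)`. -/
theorem F2deriv_strictAntiOn (ω χ ζ γ : ℝ)
    (hω : 0 < ω) (hχ : 0 < χ) (hζ : 0 < ζ) (hγ : γ = ω * χ) :
    StrictAntiOn (F2deriv ω χ γ ζ) (Set.Ioi 0) := by
  refine strictAntiOn_of_deriv_neg (convex_Ioi 0)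
    (fun P hP => (hasDerivAt_F2deriv ω χ γ ζ (ne_of_gt hP)).continuousAt.continuousWithinAt) ?_
  intro P hP
  rw [interior_Ioi, Set.mem_Ioi] at hP
  rw [(hasDerivAt_F2deriv ω χ γ ζ hP.ne').deriv]
  have : 0 < ζ * Real.exp (ω / P) * (((ω - P) ^ 2 + P ^ 2) / P ^ 2) := by positivity
  linarith
end

section
/- Fix real parameters ω > 0, χ > 0, ζ > 0 and set γ = ωχ. Define F₂′(P) = −2χP + γ + ζ e^{ω/P}(ω − 2P) for P > 0. Then there exists a unique β > 0 such that F₂′(β) = 0; moreover F₂′(P) > 0 for 0 < P < β and F₂′(P) < 0 for P > β. -/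
theorem F2deriv_eq_mul (ω χ ζ P : ℝ) :
    F2deriv ω χ (ω * χ) ζ P = (ω - 2 * P) * (χ + ζ * Real.exp (ω / P)) := by
  unfold F2deriv
  ring

/-- There exists a unique `β > 0` with `F₂'(β) = 0`; moreover `F₂'(P) > 0` for
`0 < P < β` and `F₂'(P) < 0` for `P > β`. -/
theorem F2deriv_unique_zero (ω χ ζ γ : ℝ)
    (hω : 0 < ω) (hχ : 0 < χ) (hζ : 0 < ζ) (hγ : γ = ω * χ) :
    ∃ β : ℝ, 0 < β ∧ F2deriv ω χ γ ζ β = 0 ∧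
      (∀ P, 0 < P → P < β → 0 < F2deriv ω χ γ ζ P) ∧
      (∀ P, β < P → F2deriv ω χ γ ζ P < 0) ∧
      (∀ β' : ℝ, 0 < β' → F2deriv ω χ γ ζ β' = 0 → β' = β) := by
  subst hγ
  have hpos (P : ℝ) : 0 < χ + ζ * Real.exp (ω / P) := by positivity
  simp only [F2deriv_eq_mul]
  refine ⟨ω / 2, by positivity, by ring, fun P _ hP => ?_, fun P hP => ?_, fun P _ hP => ?_⟩
  · exact mul_pos (by linarith) (hpos P)
  · exact mul_neg_of_neg_of_pos (by linarith) (hpos P)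
  · have := (mul_eq_zero.mp hP).resolve_right (hpos P).ne'
    linarith
end

section
/- Fix real parameters ω > 0, χ > 0, ζ > 0, C > 0 and set γ = ωχ, μ = γC. Define η(P) = (χ e^{−ω/P} + ζ)/(P + C) and F₂(P) = −χP² + γP + μ − ζP²e^{ω/P} for P > 0, and let β > 0 be the unique zero of F₂′(P) = −2χP + γ + ζ e^{ω/P}(ω − 2P). If F₂(β) ≤ 0, then η is strictly decreasing on (0, ∞). -/
/-- Energy efficiency of one multicast group as a function of its transmit power `P`:
`η(P) = (χ e^{-ω/P} + ζ)/(P + C)`. -/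
noncomputable def eta (ω χ ζ C : ℝ) (P : ℝ) : ℝ :=
  (χ * Real.exp (-ω / P) + ζ) / (P + C)

/-- The auxiliary function `F₂(P) = -χ P² + γ P + μ - ζ P² e^{ω/P}`. -/
noncomputable def F2 (ω χ γ μ ζ : ℝ) (P : ℝ) : ℝ :=
  -χ * P ^ 2 + γ * P + μ - ζ * P ^ 2 * Real.exp (ω / P)

/-- The function `P ↦ P² e^{ω/P}` is bounded below on `(0, ∞)` by its value at `ω/2`. -/
theorem sq_mul_exp_div_ge {ω P : ℝ} (hω : 0 < ω) (hP : 0 < P) :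
    (ω / 2) ^ 2 * Real.exp (ω / (ω / 2)) ≤ P ^ 2 * Real.exp (ω / P) := by
  have h2 : ω / (ω / 2) = 2 := by field_simp
  have hexp : Real.exp (ω / P) = Real.exp 2 * Real.exp (ω / (2 * P) - 1) ^ 2 := by
    rw [← Real.exp_nat_mul, ← Real.exp_add]
    congr 1
    push_cast
    field_simp
    ring
  have hle : ω / (2 * P) ≤ Real.exp (ω / (2 * P) - 1) := by
    simpa using Real.add_one_le_exp (ω / (2 * P) - 1)
  have hmul : ω / 2 ≤ P * Real.exp (ω / (2 * P) - 1) := by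
    calc ω / 2 = P * (ω / (2 * P)) := by field_simp
      _ ≤ _ := by gcongr
  calc (ω / 2) ^ 2 * Real.exp (ω / (ω / 2))
      ≤ (P * Real.exp (ω / (2 * P) - 1)) ^ 2 * Real.exp 2 := by rw [h2]; gcongr
    _ = P ^ 2 * Real.exp (ω / P) := by rw [hexp]; ring

/-- `F₂` lies below a downward parabola with vertex at `ω/2`. -/
theorem F2_le_F2_half_sub {ω χ ζ P : ℝ} (μ : ℝ) (hω : 0 < ω) (hζ : 0 ≤ ζ) (hP : 0 < P) :
    F2 ω χ (ω * χ) μ ζ P ≤ F2 ω χ (ω * χ) μ ζ (ω / 2) - χ * (P - ω / 2) ^ 2 := by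
  have h := mul_le_mul_of_nonneg_left (sq_mul_exp_div_ge hω hP) hζ
  unfold F2
  linarith

/-- The only zero of `F₂'` is `ω/2`. -/
theorem eq_half_of_F2deriv_eq_zero {ω χ ζ P : ℝ} (hχ : 0 < χ) (hζ : 0 < ζ)
    (h : F2deriv ω χ (ω * χ) ζ P = 0) : P = ω / 2 := by
  have hfac : (χ + ζ * Real.exp (ω / P)) * (ω - 2 * P) = 0 := by
    unfold F2deriv at h
    linarith
  have hpos : χ + ζ * Real.exp (ω / P) ≠ 0 := by positivity
  linarith [(mul_eq_zero.mp hfac).resolve_left hpos]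

/-- The derivative of `η` is a positive multiple of `F₂`. -/
theorem hasDerivAt_eta {ω χ ζ C P : ℝ} (hC : 0 < C) (hP : 0 < P) :
    HasDerivAt (eta ω χ ζ C)
      (Real.exp (-ω / P) / (P ^ 2 * (P + C) ^ 2) * F2 ω χ (ω * χ) (ω * χ * C) ζ P) P := by
  have hPC : P + C ≠ 0 := by positivity
  have hdiv : HasDerivAt (fun x : ℝ => -ω / x) (ω / P ^ 2) P :=
    ((hasDerivAt_const P (-ω)).fun_div (hasDerivAt_id' P) hP.ne').congr_deriv (by ring)
  have h := ((hdiv.exp.const_mul χ).add_const ζ).fun_div ((hasDerivAt_id' P).add_const C) hPC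
  refine h.congr_deriv ?_
  have hexp : Real.exp (-ω / P) = (Real.exp (ω / P))⁻¹ := by
    rw [neg_div, Real.exp_neg]
  have hne := Real.exp_ne_zero (ω / P)
  unfold F2
  rw [hexp]
  field_simp
  ring

/-- Case (i): if `F₂(β) ≤ 0`, where `β > 0` is the unique zero of `F₂'`, then `η` is
strictly decreasing on `(0, ∞)`. -/
theorem eta_strictAntiOn_of_F2_nonpos (ω χ ζ C γ μ : ℝ)
    (hω : 0 < ω) (hχ : 0 < χ) (hζ : 0 < ζ) (hC : 0 < C)
    (hγ : γ = ω * χ) (hμ : μ = γ * C)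
    (β : ℝ) (hβ : 0 < β) (hβ0 : F2deriv ω χ γ ζ β = 0)
    (hβuniq : ∀ x : ℝ, 0 < x → F2deriv ω χ γ ζ x = 0 → x = β)
    (hneg : F2 ω χ γ μ ζ β ≤ 0) :
    StrictAntiOn (eta ω χ ζ C) (Set.Ioi 0) := by
  subst hγ hμ
  obtain rfl : β = ω / 2 := eq_half_of_F2deriv_eq_zero hχ hζ hβ0
  have hderiv : ∀ P : ℝ, 0 < P → P ≠ ω / 2 → deriv (eta ω χ ζ C) P < 0 := by
    intro P hP hne
    rw [(hasDerivAt_eta hC hP).deriv]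
    refine mul_neg_of_pos_of_neg (by positivity) ?_
    have hsq : 0 < χ * (P - ω / 2) ^ 2 := mul_pos hχ (sq_pos_of_ne_zero (sub_ne_zero.mpr hne))
    linarith [F2_le_F2_half_sub (χ := χ) (ω * χ * C) hω hζ.le hP]
  have hcont : ContinuousOn (eta ω χ ζ C) (Set.Ioi 0) := fun P hP =>
    (hasDerivAt_eta hC hP).continuousAt.continuousWithinAt
  rw [← Set.Ioc_union_Ici_eq_Ioi hβ]
  refine StrictAntiOn.union (c := ω / 2) ?_ ?_ (isGreatest_Ioc hβ) isLeast_Ici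
  · refine strictAntiOn_of_deriv_neg (convex_Ioc _ _)
      (hcont.mono Set.Ioc_subset_Ioi_self) fun P hP => ?_
    rw [interior_Ioc] at hP
    exact hderiv P hP.1 hP.2.ne
  · refine strictAntiOn_of_deriv_neg (convex_Ici _)
      (hcont.mono (Set.Ici_subset_Ioi.mpr hβ)) fun P hP => ?_
    rw [interior_Ici] at hP
    exact hderiv P (hβ.trans hP) (ne_of_gt hP)
end

section
/- Fix real parameters φ > 0, S ≥ 0, D > 0. Define η(R) = (R e^{−φ(2^R − 1)} + S)/D for R > 0, and let δ > 0 be the unique positive zero of L₂(R) = 1 − φ R 2^R ln 2. Then η is strictly increasing on (0, δ] and strictly decreasing on [δ, ∞); consequently δ is the unique global maximizer of η on (0, ∞), i.e., η(R) < η(δ) for every R > 0 with R ≠ δ. -/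
/-- Energy efficiency of one multicast group as a function of its target rate `R`:
`η(R) = (R e^{-φ(2^R - 1)} + S)/D`. -/
noncomputable def etaR (φ S D : ℝ) (R : ℝ) : ℝ :=
  (R * Real.exp (-(φ * ((2 : ℝ) ^ R - 1))) + S) / D

/-- `L₂(R) = 1 - φ R 2^R ln 2`. -/
noncomputable def L2 (φ : ℝ) (R : ℝ) : ℝ :=
  1 - φ * R * (2 : ℝ) ^ R * Real.log 2

theorem hasDerivAt_etaR (φ S D R : ℝ) :
    HasDerivAt (etaR φ S D) (Real.exp (-(φ * ((2 : ℝ) ^ R - 1))) * L2 φ R / D) R := by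
  have hpow : HasDerivAt (fun x : ℝ => (2 : ℝ) ^ x) (Real.log 2 * 1 * (2 : ℝ) ^ R) R :=
    (hasDerivAt_id R).const_rpow two_pos
  have hexp := (((hpow.sub_const 1).const_mul φ).neg).exp
  have h := (((hasDerivAt_id R).mul hexp).add_const S).div_const D
  refine h.congr_deriv ?_
  simp only [L2, id, Pi.neg_apply]
  ring

theorem L2_strictAntiOn {φ : ℝ} (hφ : 0 < φ) : StrictAntiOn (L2 φ) (Set.Ici 0) := by
  intro x hx y _ hxy
  have hx0 : 0 ≤ x := hx
  have hlog : 0 < Real.log 2 := Real.log_pos one_lt_two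
  have hpow : (2 : ℝ) ^ x ≤ (2 : ℝ) ^ y :=
    Real.rpow_le_rpow_of_exponent_le one_le_two hxy.le
  have hmul : x * (2 : ℝ) ^ x < y * (2 : ℝ) ^ y :=
    mul_lt_mul hxy hpow (Real.rpow_pos_of_pos two_pos x) (hx0.trans hxy.le)
  have h := mul_lt_mul_of_pos_left hmul (mul_pos hφ hlog)
  simp only [L2]
  linarith

/-- If `δ > 0` is the unique positive zero of `L₂`, then `η` is strictly increasing on
`(0, δ]`, strictly decreasing on `[δ, ∞)`, and `δ` is the unique global maximizer of `η`
on `(0, ∞)`. -/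
theorem etaR_max_at_delta (φ S D : ℝ) (hφ : 0 < φ) (hS : 0 ≤ S) (hD : 0 < D)
    (δ : ℝ) (hδ : 0 < δ) (hδ0 : L2 φ δ = 0)
    (hδuniq : ∀ x : ℝ, 0 < x → L2 φ x = 0 → x = δ) :
    StrictMonoOn (etaR φ S D) (Set.Ioc 0 δ) ∧
    StrictAntiOn (etaR φ S D) (Set.Ici δ) ∧
    (∀ R : ℝ, 0 < R → R ≠ δ → etaR φ S D R < etaR φ S D δ) := by
  have hcont : Continuous (etaR φ S D) :=
    continuous_iff_continuousAt.2 fun R => (hasDerivAt_etaR φ S D R).continuousAt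
  have hmono : StrictMonoOn (etaR φ S D) (Set.Ioc 0 δ) := by
    refine strictMonoOn_of_deriv_pos (convex_Ioc 0 δ) hcont.continuousOn fun x hx => ?_
    rw [interior_Ioc] at hx
    rw [(hasDerivAt_etaR φ S D x).deriv]
    have hL : 0 < L2 φ x := hδ0 ▸ L2_strictAntiOn hφ hx.1.le hδ.le hx.2
    positivity
  have hanti : StrictAntiOn (etaR φ S D) (Set.Ici δ) := by
    refine strictAntiOn_of_deriv_neg (convex_Ici δ) hcont.continuousOn fun x hx => ?_
    rw [interior_Ici] at hx
    rw [(hasDerivAt_etaR φ S D x).deriv]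
    have hL : L2 φ x < 0 := hδ0 ▸ L2_strictAntiOn hφ hδ.le (hδ.trans hx).le hx
    exact div_neg_of_neg_of_pos (mul_neg_of_pos_of_neg (Real.exp_pos _) hL) hD
  refine ⟨hmono, hanti, fun R hR hne => ?_⟩
  rcases lt_or_gt_of_ne hne with h | h
  · exact hmono ⟨hR, h.le⟩ ⟨hδ, le_rfl⟩ h
  · exact hanti Set.self_mem_Ici h.le h
end

section
/- Fix real parameters φ > 0, S ≥ 0, D > 0. Define η(R) = (R e^{−φ(2^R − 1)} + S)/D for R > 0. Then η is quasi-concave on (0, ∞): for all 0 < a < b < c, η(b) ≥ min(η(a), η(c)). -/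
theorem concaveOn_log_sub_mul_two_rpow {φ : ℝ} (hφ : 0 ≤ φ) :
    ConcaveOn ℝ (Set.Ioi 0) fun R : ℝ => Real.log R - φ * ((2 : ℝ) ^ R - 1) := by
  have hpow : ConvexOn ℝ (Set.Ioi 0) fun R : ℝ => (2 : ℝ) ^ R :=
    (convexOn_rpow_left two_pos).subset (Set.subset_univ _) (convex_Ioi 0)
  have hconv : ConvexOn ℝ (Set.Ioi 0) fun R : ℝ => φ * ((2 : ℝ) ^ R - 1) := by
    simpa [sub_eq_add_neg] using (hpow.add_const (-1)).smul hφ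
  exact strictConcaveOn_log_Ioi.concaveOn.sub hconv

theorem etaR_eq_exp (φ S D : ℝ) {R : ℝ} (hR : 0 < R) :
    etaR φ S D R = (Real.exp (Real.log R - φ * ((2 : ℝ) ^ R - 1)) + S) / D := by
  rw [etaR, sub_eq_add_neg (Real.log R), Real.exp_add, Real.exp_log hR]

/-- `η` is quasi-concave on `(0, ∞)`: for all `0 < a < b < c`,
`η(b) ≥ min (η(a)) (η(c))`. -/
theorem etaR_quasiconcave (φ S D : ℝ) (hφ : 0 < φ) (hS : 0 ≤ S) (hD : 0 < D) :
    ∀ a b c : ℝ, 0 < a → a < b → b < c →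
      min (etaR φ S D a) (etaR φ S D c) ≤ etaR φ S D b := by
  intro a b c ha hab hbc
  have hb := ha.trans hab
  have hc := hb.trans hbc
  rw [etaR_eq_exp φ S D ha, etaR_eq_exp φ S D hb, etaR_eq_exp φ S D hc, min_le_iff]
  refine (min_le_iff.mp ((concaveOn_log_sub_mul_two_rpow hφ.le).min_le_of_mem_Icc
    ha hc ⟨hab.le, hbc.le⟩)).imp (fun h => ?_) (fun h => ?_) <;> gcongr
end
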